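/- Let f : R → σ⁻¹R be a universally σ-inverting ring homomorphism and let T be an (R,σ)-module. If T = A ⊕ B as left R-modules, then A (and likewise B) is an (R,σ)-module; in other words, every direct summand of an (R,σ)-module is an (R,σ)-module, so the category of (R,σ)-modules is idempotent complete. -/

import Mathlib

open MulOpposite

universe u

section BTensorCore

variable (R : Type u) [Ring R]
variable (M : Type u) [AddCommGroup M] [Module Rᵐᵒᵖ M]
variable (N : Type u) [AddCommGroup N] [Module R N]

/-- The subgroup of relations defining the balanced tensor product `M ⊗_R N`. -/
noncomputable def btRel : AddSubgroup (TensorProduct ℤ M N) :=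
  AddSubgroup.closure
    { x | ∃ (m : M) (r : R) (n : N), x = (op r • m) ⊗ₜ[ℤ] n - m ⊗ₜ[ℤ] (r • n) }

/-- The balanced tensor product `M ⊗_R N` of a right `R`-module `M` and a left `R`-module `N`:
the quotient of `M ⊗_ℤ N` by the relations `(m · r) ⊗ n = m ⊗ (r · n)`. -/
abbrev BTensor : Type u := TensorProduct ℤ M N ⧸ btRel R M N

variable {R M N}

/-- The image of `m ⊗ n` in `M ⊗_R N`. -/
noncomputable def BTensor.tmul (m : M) (n : N) : BTensor R M N :=
  QuotientAddGroup.mk (m ⊗ₜ[ℤ] n)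

variable {A : Type u} [AddCommGroup A]

/-- Lift a balanced biadditive map `M → N → A` to `M ⊗_R N → A`. -/
noncomputable def BTensor.lift (b : M →+ N →+ A)
    (hb : ∀ (r : R) (m : M) (n : N), b (op r • m) n = b m (r • n)) :
    BTensor R M N →+ A :=
  QuotientAddGroup.lift (btRel R M N)
    (TensorProduct.liftAddHom b (fun z m n => by
      simp [map_zsmul]))
    ((AddSubgroup.closure_le _).mpr (by
      rintro y ⟨m, r, n, rfl⟩
      simp [AddMonoidHom.mem_ker, hb r m n]))

/-- Lift a balanced biadditive map given as a bare function. -/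
noncomputable def BTensor.lift' (b : M → N → A)
    (h1 : ∀ m m' n, b (m + m') n = b m n + b m' n)
    (h2 : ∀ m n n', b m (n + n') = b m n + b m n')
    (hb : ∀ (r : R) m n, b (op r • m) n = b m (r • n)) :
    BTensor R M N →+ A :=
  BTensor.lift (AddMonoidHom.mk' (fun m => AddMonoidHom.mk' (b m) (h2 m))
    (fun m m' => AddMonoidHom.ext fun n => h1 m m' n)) hb

section MapRight

variable {N' : Type u} [AddCommGroup N'] [Module R N']

/-- The map `1 ⊗ g : M ⊗_R N → M ⊗_R N'` induced by a map `g` of left `R`-modules. -/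
noncomputable def BTensor.mapRight (g : N →ₗ[R] N') : BTensor R M N →+ BTensor R M N' :=
  QuotientAddGroup.map _ _
    (TensorProduct.map (LinearMap.id (R := ℤ) (M := M)) g.toAddMonoidHom.toIntLinearMap).toAddMonoidHom
    ((AddSubgroup.closure_le _).mpr (by
      rintro y ⟨m, r, n, rfl⟩
      refine AddSubgroup.mem_comap.mpr (AddSubgroup.subset_closure ?_)
      exact ⟨m, r, g n, by simp⟩))

end MapRight

section MapLeft

variable {M' : Type u} [AddCommGroup M'] [Module Rᵐᵒᵖ M']

/-- The map `g ⊗ 1 : M ⊗_R N → M' ⊗_R N` induced by a map `g` of right `R`-modules. -/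
noncomputable def BTensor.mapLeft (g : M →ₗ[Rᵐᵒᵖ] M') : BTensor R M N →+ BTensor R M' N :=
  QuotientAddGroup.map _ _
    (TensorProduct.map g.toAddMonoidHom.toIntLinearMap (LinearMap.id (R := ℤ) (M := N))).toAddMonoidHom
    ((AddSubgroup.closure_le _).mpr (by
      rintro y ⟨m, r, n, rfl⟩
      refine AddSubgroup.mem_comap.mpr (AddSubgroup.subset_closure ?_)
      exact ⟨g m, r, n, by simp⟩))

end MapLeft

end BTensorCore
section Localization

variable {R : Type u} [Ring R] {ι : Type u}
  {P Q : ι → Type u}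
  [∀ i, AddCommGroup (P i)] [∀ i, Module R (P i)]
  [∀ i, AddCommGroup (Q i)] [∀ i, Module R (Q i)]

/-- A ring homomorphism `f : R → S`, together with a right `R`-module structure on `S`, is
`σ`-inverting if the right `R`-action on `S` is the one induced by `f` (i.e. `x • r = x * f r`)
and, for every `s i : P i → Q i` in `σ`, the induced map
`1 ⊗ s i : S ⊗_R P i → S ⊗_R Q i` is bijective. -/
def IsInvertingHom (s : ∀ i, P i →ₗ[R] Q i) (S : Type u) [Ring S] [Module Rᵐᵒᵖ S]
    (f : R →+* S) : Prop :=
  (∀ (r : R) (x : S), op r • x = x * f r) ∧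
    ∀ i, Function.Bijective (BTensor.mapRight (M := S) (s i))

/-- `f : R → S` is universally `σ`-inverting if it is `σ`-inverting and every `σ`-inverting
ring homomorphism `g : R → T` factors through `f` by a unique ring homomorphism `S → T`. -/
def IsUniversalInverting (s : ∀ i, P i →ₗ[R] Q i) (S : Type u) [Ring S] [Module Rᵐᵒᵖ S]
    (f : R →+* S) : Prop :=
  IsInvertingHom s S f ∧
    ∀ (T : Type u) (_ : Ring T) (_ : Module Rᵐᵒᵖ T) (g : R →+* T),
      IsInvertingHom s T g → ∃! h : S →+* T, g = h.comp f

/-- An `(R,σ)`-module (with respect to the localization `S = σ⁻¹R`): a left `R`-module `T`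
admitting an exact sequence `0 → P₀ → Q₀ → T → 0` of left `R`-modules in which `P₀` and `Q₀`
are finitely generated projective and the map `P₀ → Q₀` becomes bijective after applying
`σ⁻¹R ⊗_R -`. -/
def IsRSigmaModule (R : Type u) [Ring R] (S : Type u) [Ring S] [Module Rᵐᵒᵖ S]
    (T : Type u) [AddCommGroup T] [Module R T] : Prop :=
  ∃ (P₀ Q₀ : Type u) (_ : AddCommGroup P₀) (_ : Module R P₀)
    (_ : AddCommGroup Q₀) (_ : Module R Q₀),
    Module.Finite R P₀ ∧ Module.Projective R P₀ ∧
    Module.Finite R Q₀ ∧ Module.Projective R Q₀ ∧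
    ∃ (t : P₀ →ₗ[R] Q₀) (p : Q₀ →ₗ[R] T),
      Function.Injective t ∧ Function.Surjective p ∧
      (∀ x, p x = 0 ↔ x ∈ Set.range t) ∧
      Function.Bijective (BTensor.mapRight (M := S) t)

section RetractOfPresentation

variable {M : Type u} [AddCommGroup M] [Module Rᵐᵒᵖ M]
  {N N' N'' : Type u} [AddCommGroup N] [Module R N] [AddCommGroup N'] [Module R N']
  [AddCommGroup N''] [Module R N'']

theorem BTensor.mapRight_tmul (g : N →ₗ[R] N') (m : M) (n : N) :
    BTensor.mapRight g (BTensor.tmul m n) = BTensor.tmul (R := R) m (g n) :=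
  rfl

theorem BTensor.tmul_add (m : M) (n n' : N) :
    BTensor.tmul (R := R) m (n + n') = BTensor.tmul m n + BTensor.tmul m n' := by
  simp [BTensor.tmul, TensorProduct.tmul_add]

@[elab_as_elim]
theorem BTensor.induction_on {p : BTensor R M N → Prop} (x : BTensor R M N) (zero : p 0)
    (tmul : ∀ m n, p (BTensor.tmul m n)) (add : ∀ x y, p x → p y → p (x + y)) : p x := by
  obtain ⟨x, rfl⟩ := QuotientAddGroup.mk_surjective x
  induction x using TensorProduct.induction_on with
  | zero => exact zero
  | tmul m n => exact tmul m n
  | add x y hx hy => exact add _ _ hx hy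

theorem BTensor.mapRight_id (x : BTensor R M N) :
    BTensor.mapRight (LinearMap.id : N →ₗ[R] N) x = x := by
  induction x using BTensor.induction_on with
  | zero => exact map_zero _
  | tmul m n => rfl
  | add x y hx hy => rw [map_add, hx, hy]

theorem BTensor.mapRight_comp (g' : N' →ₗ[R] N'') (g : N →ₗ[R] N') (x : BTensor R M N) :
    BTensor.mapRight (g' ∘ₗ g) x = BTensor.mapRight g' (BTensor.mapRight g x) := by
  induction x using BTensor.induction_on with
  | zero => simp only [map_zero]
  | tmul m n => rfl
  | add x y hx hy => simp only [map_add, hx, hy]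

theorem BTensor.mapRight_add (g g' : N →ₗ[R] N') (x : BTensor R M N) :
    BTensor.mapRight (g + g') x = BTensor.mapRight g x + BTensor.mapRight g' x := by
  induction x using BTensor.induction_on with
  | zero => simp only [map_zero, add_zero]
  | tmul m n => simp only [BTensor.mapRight_tmul, LinearMap.add_apply, BTensor.tmul_add]
  | add x y hx hy => simp only [map_add, hx, hy]; abel

/-- If the two-term complex `i : K → Q'` is a retract up to homotopy of `t : P → Q`, and
`1 ⊗ t` is bijective, then so is `1 ⊗ i`. -/
theorem BTensor.mapRight_bijective_of_homotopyRetract {K Q' P Q : Type u}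
    [AddCommGroup K] [Module R K] [AddCommGroup Q'] [Module R Q']
    [AddCommGroup P] [Module R P] [AddCommGroup Q] [Module R Q]
    {i : K →ₗ[R] Q'} {t : P →ₗ[R] Q} {a₁ : P →ₗ[R] K} {a₀ : Q →ₗ[R] Q'}
    {b₁ : K →ₗ[R] P} {b₀ : Q' →ₗ[R] Q} {h : Q' →ₗ[R] K}
    (ha : i ∘ₗ a₁ = a₀ ∘ₗ t) (hb : t ∘ₗ b₁ = b₀ ∘ₗ i)
    (h₁ : a₁ ∘ₗ b₁ + h ∘ₗ i = LinearMap.id) (h₀ : a₀ ∘ₗ b₀ + i ∘ₗ h = LinearMap.id)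
    (ht : Function.Bijective (BTensor.mapRight (M := M) t)) :
    Function.Bijective (BTensor.mapRight (M := M) i) := by
  constructor
  · rw [injective_iff_map_eq_zero]
    intro x hx
    have hbx : BTensor.mapRight b₁ x = 0 := by
      apply ht.1
      rw [← BTensor.mapRight_comp, hb, BTensor.mapRight_comp, hx, map_zero, map_zero]
    rw [← BTensor.mapRight_id x, ← h₁, BTensor.mapRight_add, BTensor.mapRight_comp,
      BTensor.mapRight_comp, hbx, hx, map_zero, map_zero, add_zero]
  · intro y
    obtain ⟨z, hz⟩ := ht.2 (BTensor.mapRight b₀ y)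
    refine ⟨BTensor.mapRight a₁ z + BTensor.mapRight h y, ?_⟩
    rw [map_add, ← BTensor.mapRight_comp, ha, BTensor.mapRight_comp, hz,
      ← BTensor.mapRight_comp, ← BTensor.mapRight_comp, ← BTensor.mapRight_add, h₀,
      BTensor.mapRight_id]

/-- A retract of an `(R,σ)`-module is an `(R,σ)`-module. -/
theorem IsRSigmaModule.of_retract {S : Type u} [Ring S] [Module Rᵐᵒᵖ S]
    {T A : Type u} [AddCommGroup T] [Module R T] [AddCommGroup A] [Module R A]
    (hT : IsRSigmaModule R S T) (j : A →ₗ[R] T) (π : T →ₗ[R] A)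
    (hπj : π ∘ₗ j = LinearMap.id) : IsRSigmaModule R S A := by
  obtain ⟨P₀, Q₀, _, _, _, _, _, _, _, _, t, p, htinj, hpsurj, hexact, hbij⟩ := hT
  have hπj' (x : A) : π (j x) = x := LinearMap.congr_fun hπj x
  have hpt (x : P₀) : p (t x) = 0 := (hexact _).2 ⟨x, rfl⟩
  let q : Q₀ →ₗ[R] A := π ∘ₗ p
  let i : LinearMap.ker q →ₗ[R] Q₀ := (LinearMap.ker q).subtype
  have hi : Function.Injective i := Subtype.val_injective
  obtain ⟨b₀, hb₀⟩ := Module.projective_lifting_property p (j ∘ₗ q) hpsurj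
  have hb₀' (x : Q₀) : p (b₀ x) = j (q x) := LinearMap.congr_fun hb₀ x
  let a₁ : P₀ →ₗ[R] LinearMap.ker q :=
    t.codRestrict _ fun x => by simp [q, hpt]
  let h : Q₀ →ₗ[R] LinearMap.ker q :=
    (LinearMap.id - b₀).codRestrict _ fun x => by
      simp [q, hb₀', hπj']
  have hmem (x : LinearMap.ker q) : (b₀ ∘ₗ i) x ∈ LinearMap.range t := by
    refine (hexact _).1 ?_
    have hx : q (i x) = 0 := x.2
    rw [LinearMap.comp_apply, hb₀', hx, map_zero]
  let b₁ : LinearMap.ker q →ₗ[R] P₀ :=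
    (LinearEquiv.ofInjective t htinj).symm.toLinearMap ∘ₗ (b₀ ∘ₗ i).codRestrict _ hmem
  have hb₁ (x : LinearMap.ker q) : t (b₁ x) = b₀ (i x) :=
    congrArg Subtype.val ((LinearEquiv.ofInjective t htinj).apply_symm_apply
      ((b₀ ∘ₗ i).codRestrict _ hmem x))
  have h₀ : LinearMap.id ∘ₗ b₀ + i ∘ₗ h = LinearMap.id := by
    ext x
    simp [i, h]
  have h₁ : a₁ ∘ₗ b₁ + h ∘ₗ i = LinearMap.id := by
    refine LinearMap.ext fun x => hi ?_
    change t (b₁ x) + (i x - b₀ (i x)) = i x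
    rw [hb₁, add_sub_cancel]
  have hsplit : a₁.coprod h ∘ₗ b₁.prod i = LinearMap.id := by
    rw [LinearMap.coprod_comp_prod, h₁]
  refine ⟨LinearMap.ker q, Q₀, inferInstance, inferInstance, inferInstance, inferInstance,
    Module.Finite.of_surjective (a₁.coprod h)
      (LinearMap.surjective_of_comp_eq_id _ _ hsplit),
    Module.Projective.of_split _ _ hsplit, inferInstance, inferInstance, i, q, hi,
    fun x => ?_, fun x => ?_, ?_⟩
  · obtain ⟨y, hy⟩ := hpsurj (j x)
    exact ⟨y, by simp [q, hy, hπj']⟩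
  · simp [i]
  · exact BTensor.mapRight_bijective_of_homotopyRetract (a₀ := LinearMap.id) (b₀ := b₀)
      (a₁ := a₁) (b₁ := b₁) (h := h) rfl (LinearMap.ext hb₁) h₁ h₀ hbij

end RetractOfPresentation

/-- Given a universally `σ`-inverting `f : R → σ⁻¹R`, every direct summand of an
`(R,σ)`-module is an `(R,σ)`-module: if `T ≅ A ⊕ B` as left `R`-modules and `T` is an
`(R,σ)`-module, then so are `A` and `B`. Thus the category of `(R,σ)`-modules is idempotent
complete. -/
theorem isRSigmaModule_of_directSummand
    (s : ∀ i, P i →ₗ[R] Q i)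
    (hPfin : ∀ i, Module.Finite R (P i)) (hPproj : ∀ i, Module.Projective R (P i))
    (hQfin : ∀ i, Module.Finite R (Q i)) (hQproj : ∀ i, Module.Projective R (Q i))
    (S : Type u) [Ring S] [Module Rᵐᵒᵖ S] (f : R →+* S)
    (huniv : IsUniversalInverting s S f)
    (T A B : Type u) [AddCommGroup T] [Module R T] [AddCommGroup A] [Module R A]
    [AddCommGroup B] [Module R B]
    (e : T ≃ₗ[R] A × B)
    (hT : IsRSigmaModule R S T) :
    IsRSigmaModule R S A ∧ IsRSigmaModule R S B := by
  refine ⟨hT.of_retract (e.symm.toLinearMap ∘ₗ LinearMap.inl R A B)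
      (LinearMap.fst R A B ∘ₗ e.toLinearMap) ?_,
    hT.of_retract (e.symm.toLinearMap ∘ₗ LinearMap.inr R A B)
      (LinearMap.snd R A B ∘ₗ e.toLinearMap) ?_⟩ <;>
  · ext x
    simp

end Localization
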